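/- Let L = 6, x₀ = 1.5, R_int = 0.47, and let d : [−L, L] → ℝ be the piecewise blending function with d(x) = (x + L)/(x₀ + R_int − L) on [−L, −x₀ − R_int], d ≡ −1 on [−x₀ − R_int, −x₀ + R_int], d(x) = x/(x₀ − R_int) on [−x₀ + R_int, x₀ − R_int], d ≡ 1 on [x₀ − R_int, x₀ + R_int], and d(x) = (x − L)/(x₀ + R_int − L) on [x₀ + R_int, L]. For μ₂ ∈ ℝ define T_{μ₂}(x) = x − (x₀ μ₂ / 3) d(x). Then for every μ₂ ∈ [−3, 2], T_{μ₂} is strictly increasing and continuous on [−L, L], fixes the endpoints (T_{μ₂}(−L) = −L and T_{μ₂}(L) = L), and is a bijection of [−L, L] onto itself. -/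

import Mathlib

theorem glue_aux (g : ℝ → ℝ) (a b c : ℝ) (hab : a ≤ b) (hbc : b ≤ c)
    (h : StrictMonoOn g (Set.Icc a b) ∧ ContinuousOn g (Set.Icc a b))
    (h' : StrictMonoOn g (Set.Icc b c) ∧ ContinuousOn g (Set.Icc b c)) :
    StrictMonoOn g (Set.Icc a c) ∧ ContinuousOn g (Set.Icc a c) := by
  rw [← Set.Icc_union_Icc_eq_Icc hab hbc]
  exact ⟨h.1.union h'.1 (isGreatest_Icc hab) (isLeast_Icc hbc),
    h.2.union_of_isClosed h'.2 isClosed_Icc isClosed_Icc⟩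

theorem affine_aux (g : ℝ → ℝ) (a b m k : ℝ) (hm : 0 < m)
    (h : ∀ x ∈ Set.Icc a b, g x = m * x + k) :
    StrictMonoOn g (Set.Icc a b) ∧ ContinuousOn g (Set.Icc a b) := by
  constructor
  · intro x hx y hy hxy
    rw [h x hx, h y hy]
    have := mul_lt_mul_of_pos_left hxy hm
    linarith
  · have hc : ContinuousOn (fun x : ℝ => m * x + k) (Set.Icc a b) := by fun_prop
    exact hc.congr h

/-- For every μ₂ ∈ [−3, 2], the horizontal coordinate transformation
`T μ₂ x = x − (x₀ μ₂/3) d(x)` of the distance mapping is strictly increasing and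
continuous on `[−6, 6]`, fixes the endpoints, and is a bijection of `[−6, 6]` onto itself. -/
theorem distance_mapping_bijective
    (f : ℝ → ℝ)
    (h1 : ∀ x ∈ Set.Icc (-6 : ℝ) (-(1.5 + 0.47)), f x = (x + 6) / (1.5 + 0.47 - 6))
    (h2 : ∀ x ∈ Set.Icc (-(1.5 + 0.47) : ℝ) (-(1.5 - 0.47)), f x = -1)
    (h3 : ∀ x ∈ Set.Icc (-(1.5 - 0.47) : ℝ) (1.5 - 0.47), f x = x / (1.5 - 0.47))
    (h4 : ∀ x ∈ Set.Icc ((1.5 - 0.47) : ℝ) (1.5 + 0.47), f x = 1)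
    (h5 : ∀ x ∈ Set.Icc ((1.5 + 0.47) : ℝ) 6, f x = (x - 6) / (1.5 + 0.47 - 6))
    (T : ℝ → ℝ → ℝ)
    (hT : ∀ μ x, T μ x = x - (1.5 * μ / 3) * f x) :
    ∀ μ ∈ Set.Icc (-3 : ℝ) 2,
      StrictMonoOn (T μ) (Set.Icc (-6 : ℝ) 6) ∧
      ContinuousOn (T μ) (Set.Icc (-6 : ℝ) 6) ∧
      T μ (-6) = -6 ∧ T μ 6 = 6 ∧
      Set.BijOn (T μ) (Set.Icc (-6 : ℝ) 6) (Set.Icc (-6 : ℝ) 6) := by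
  rintro μ ⟨hμ1, hμ2⟩
  have e1 := affine_aux (T μ) _ _ (1 + μ * (50/403)) (6 * μ * (50/403)) (by linarith)
    (fun x hx => by rw [hT, h1 x hx]; ring)
  have e2 := affine_aux (T μ) _ _ 1 (μ / 2) (by norm_num)
    (fun x hx => by rw [hT, h2 x hx]; ring)
  have e3 := affine_aux (T μ) _ _ (1 - μ * (50/103)) 0 (by linarith)
    (fun x hx => by rw [hT, h3 x hx]; ring)
  have e4 := affine_aux (T μ) _ _ 1 (-μ / 2) (by norm_num)
    (fun x hx => by rw [hT, h4 x hx]; ring)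
  have e5 := affine_aux (T μ) _ _ (1 + μ * (50/403)) (-6 * μ * (50/403)) (by linarith)
    (fun x hx => by rw [hT, h5 x hx]; ring)
  obtain ⟨hmono, hcont⟩ := glue_aux _ _ _ _ (by norm_num) (by norm_num) e1
    (glue_aux _ _ _ _ (by norm_num) (by norm_num) e2
    (glue_aux _ _ _ _ (by norm_num) (by norm_num) e3
    (glue_aux _ _ _ _ (by norm_num) (by norm_num) e4 e5)))
  have hl : T μ (-6) = -6 := by
    rw [hT, h1 (-6) (by constructor <;> norm_num)]; ring
  have hr : T μ 6 = 6 := by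
    rw [hT, h5 6 (by constructor <;> norm_num)]; ring
  refine ⟨hmono, hcont, hl, hr, ?_, hmono.injOn, ?_⟩
  · intro x hx
    have p := hmono.monotoneOn (Set.left_mem_Icc.2 (by norm_num)) hx hx.1
    have q := hmono.monotoneOn hx (Set.right_mem_Icc.2 (by norm_num)) hx.2
    rw [hl] at p
    rw [hr] at q
    exact ⟨p, q⟩
  · have := intermediate_value_Icc (by norm_num : (-6 : ℝ) ≤ 6) hcont
    rw [hl, hr] at this
    exact this
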